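/- Let $V$ be a separable Hilbert space, $H\in(1/2,1)$, $-\infty\le\alpha<\beta\le\infty$, and let $f(t,x,\theta)$ be a $V$-valued function on $\mathbb{R}\times\mathbb{R}^d\times(\alpha,\beta)$, jointly measurable, infinitely differentiable with compact support in $(t,x)$ (as a function with values in $L^{1/H}((\alpha,\beta);V)$), and suppose $f(t,x,\theta)=0$ whenever $(t,x)\notin(-12,12)\times B_{3d}$. Then for every $(t,x)\in Q_0$: $\int_{Q_0}|\mathcal{G}f(s,y)|^2\,ds\,dy\;\le\;N\,\mathbb{M}_t\big[F_f(\cdot,x)\big](t),$ where $N$ depends only on $d$ and $F_f(t,x):=\left(\int_\alpha^\beta\big(\mathbb{M}_x[\|f(t,\cdot,\theta)\|_V^2](x)\big)^{1/(2H)}\,d\theta\right)^{2H}$. -/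

import Mathlib

open MeasureTheory ENNReal

/-- The heat kernel `G_t(x) = (4πt)^{-d/2} exp(-|x|²/(4t))` on `ℝ^d`. -/
noncomputable def heatKernel (d : ℕ) (t : ℝ) (x : EuclideanSpace ℝ (Fin d)) : ℝ :=
  (4 * Real.pi * t) ^ (-(d : ℝ)/2) * Real.exp (-‖x‖^2 / (4*t))

/-- The heat semigroup `T_t h (x) = ∫_{ℝ^d} h(x-y) G_t(y) dy` (Bochner integral). -/
noncomputable def heatOp (d : ℕ) {V : Type*} [NormedAddCommGroup V] [NormedSpace ℝ V]
    [CompleteSpace V] (t : ℝ) (h : EuclideanSpace ℝ (Fin d) → V)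
    (x : EuclideanSpace ℝ (Fin d)) : V :=
  ∫ y, heatKernel d t y • h (x - y)

/-- Squared norm of the spatial gradient of `T_t h` at `x`:
`‖∇ T_t h(x)‖² = ∑_{j=1}^d ‖∂_{x_j} T_t h(x)‖²`. -/
noncomputable def gradHeatNormSq (d : ℕ) {V : Type*} [NormedAddCommGroup V]
    [NormedSpace ℝ V] [CompleteSpace V] (t : ℝ) (h : EuclideanSpace ℝ (Fin d) → V)
    (x : EuclideanSpace ℝ (Fin d)) : ℝ :=
  ∑ j : Fin d, ‖fderiv ℝ (heatOp d t h) x (EuclideanSpace.single j 1)‖^2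

/-- The square-function operator
`𝒢f(t,x) = [∫_{-∞}^t (∫_α^β ‖∇T_{t-s}f(s,·,θ)(x)‖^{1/H} dθ)^{2H} ds]^{1/2}`
(note `‖∇T_{t-s}f(s,·,θ)(x)‖^{1/H} = (gradHeatNormSq ...)^{1/(2H)}`). -/
noncomputable def calG (d : ℕ) {V : Type*} [NormedAddCommGroup V] [NormedSpace ℝ V]
    [CompleteSpace V] (H : ℝ) (α β : EReal)
    (f : ℝ → EuclideanSpace ℝ (Fin d) → ℝ → V)
    (t : ℝ) (x : EuclideanSpace ℝ (Fin d)) : ℝ :=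
  (∫ s in Set.Iio t,
      (∫ θ in {θ : ℝ | α < (θ : EReal) ∧ (θ : EReal) < β},
        (gradHeatNormSq d (t - s) (fun y => f s y θ) x) ^ (1/(2*H))) ^ (2*H))
    ^ ((1:ℝ)/2)

/-- Hardy–Littlewood maximal function over balls in `ℝ^d`:
`𝕄_x g(x) = sup_{r>0} |B_r|⁻¹ ∫_{B_r(x)} |g(y)| dy`. -/
noncomputable def maxX (d : ℕ) (g : EuclideanSpace ℝ (Fin d) → ℝ)
    (x : EuclideanSpace ℝ (Fin d)) : ℝ≥0∞ :=
  ⨆ (r : ℝ) (_ : 0 < r),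
    (volume (Metric.ball x r))⁻¹ * ∫⁻ y in Metric.ball x r, ENNReal.ofReal |g y|

/-- Hardy–Littlewood maximal function over intervals in `ℝ`:
`𝕄_t k(t) = sup_{r>0} (2r)⁻¹ ∫_{t-r}^{t+r} |k(s)| ds`. -/
noncomputable def maxT (k : ℝ → ℝ≥0∞) (t : ℝ) : ℝ≥0∞ :=
  ⨆ (r : ℝ) (_ : 0 < r),
    (ENNReal.ofReal (2*r))⁻¹ * ∫⁻ s in Set.Ioo (t - r) (t + r), k s

/-- `F_f(t,x) = (∫_α^β (𝕄_x[‖f(t,·,θ)‖²](x))^{1/(2H)} dθ)^{2H}`. -/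
noncomputable def Ff (d : ℕ) {V : Type*} [NormedAddCommGroup V] (H : ℝ) (α β : EReal)
    (f : ℝ → EuclideanSpace ℝ (Fin d) → ℝ → V)
    (t : ℝ) (x : EuclideanSpace ℝ (Fin d)) : ℝ≥0∞ :=
  (∫⁻ θ in {θ : ℝ | α < (θ : EReal) ∧ (θ : EReal) < β},
      (maxX d (fun y => ‖f t y θ‖^2) x) ^ (1/(2*H))) ^ (2*H)

/-- The cube `Q₀ = [-4,0] × [-1,1]^d ⊆ ℝ^{d+1}`. -/
def cubeQ0 (d : ℕ) : Set (ℝ × EuclideanSpace ℝ (Fin d)) :=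
  Set.Icc (-4 : ℝ) 0 ×ˢ {x | ∀ j, x j ∈ Set.Icc (-1 : ℝ) 1}

theorem lintegral_rpow_lintegral_le {X Θ : Type*} [MeasurableSpace X] [MeasurableSpace Θ]
    (μ : Measure X) [IsFiniteMeasure μ] (ν : Measure Θ) [SFinite ν] {p : ℝ} (hp : 1 < p)
    {φ : X → Θ → ℝ≥0∞} (hφ : Measurable (Function.uncurry φ)) :
    ∫⁻ x, (∫⁻ θ, φ x θ ∂ν) ^ p ∂μ ≤ (∫⁻ θ, (∫⁻ x, φ x θ ^ p ∂μ) ^ (1 / p) ∂ν) ^ p := by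
  have hp0 : 0 < p := by linarith
  set S : X → ℝ≥0∞ := fun x => ∫⁻ θ, φ x θ ∂ν
  set B : ℝ≥0∞ := ∫⁻ θ, (∫⁻ x, φ x θ ^ p ∂μ) ^ (1 / p) ∂ν
  have hS : Measurable S := hφ.lintegral_prod_right'
  set q := p.conjExponent
  have hpq : q.HolderConjugate p := (Real.HolderConjugate.conjExponent hp).symm
  have key : ∀ n : ℕ, ∫⁻ x, (min (S x) n) ^ p ∂μ ≤ B ^ p := by
    intro n
    set m : X → ℝ≥0∞ := fun x => min (S x) n
    have hm : Measurable m := hS.min measurable_const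
    set A : ℝ≥0∞ := ∫⁻ x, m x ^ p ∂μ
    have hA : A ≠ ∞ := by
      refine ne_top_of_le_ne_top (b := ∫⁻ _, (n : ℝ≥0∞) ^ p ∂μ) ?_ ?_
      · simp only [lintegral_const]
        exact mul_ne_top (rpow_ne_top_of_nonneg hp0.le (natCast_ne_top n)) (measure_ne_top _ _)
      · exact lintegral_mono fun x => rpow_le_rpow (min_le_right _ _) hp0.le
    have hpt : ∀ x, m x ^ p ≤ ∫⁻ θ, m x ^ (p - 1) * φ x θ ∂ν := by
      intro x
      rw [lintegral_const_mul _ (hφ.of_uncurry_left)]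
      calc m x ^ p = m x ^ (p - 1) * m x := by
            conv_rhs => rw [← rpow_one (m x), ← rpow_mul]
            rw [← rpow_add_of_nonneg _ _ (by linarith) zero_le_one]
            congr 1; ring
        _ ≤ _ := by gcongr; exact min_le_left _ _
    have h1 : A ≤ A ^ (1 / q) * B := by
      calc A ≤ ∫⁻ x, ∫⁻ θ, m x ^ (p - 1) * φ x θ ∂ν ∂μ := lintegral_mono hpt
        _ = ∫⁻ θ, ∫⁻ x, m x ^ (p - 1) * φ x θ ∂μ ∂ν := by
            refine lintegral_lintegral_swap (Measurable.aemeasurable ?_)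
            exact ((hm.comp measurable_fst).pow_const _).mul hφ
        _ ≤ ∫⁻ θ, A ^ (1 / q) * (∫⁻ x, φ x θ ^ p ∂μ) ^ (1 / p) ∂ν := by
            refine lintegral_mono fun θ => ?_
            refine (lintegral_mul_le_Lp_mul_Lq μ hpq (hm.pow_const _).aemeasurable
              hφ.of_uncurry_right.aemeasurable).trans_eq ?_
            congr 2
            refine lintegral_congr fun x => ?_
            rw [← rpow_mul, hpq.symm.sub_one_mul_conj]
        _ = A ^ (1 / q) * B := by
            rw [lintegral_const_mul']
            exact rpow_ne_top_of_nonneg (one_div_nonneg.2 hpq.nonneg) hA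
    rcases eq_or_ne A 0 with h0 | h0
    · rw [h0]; exact zero_le
    have h2 : A = A ^ (1 / q) * A ^ (1 / p) := by
      rw [← rpow_add _ _ h0 hA, one_div, one_div, hpq.inv_add_inv_eq_one, rpow_one]
    have h3 : A ^ (1 / p) ≤ B := by
      refine (ENNReal.mul_le_mul_iff_right ?_ ?_).1 (h2.symm.le.trans h1)
      · exact (rpow_pos (pos_iff_ne_zero.2 h0) hA).ne'
      · exact rpow_ne_top_of_nonneg (one_div_nonneg.2 hpq.nonneg) hA
    calc A = (A ^ (1 / p)) ^ p := by rw [← rpow_mul, one_div_mul_cancel hp0.ne', rpow_one]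
      _ ≤ B ^ p := by gcongr
  have hlim : ∫⁻ x, S x ^ p ∂μ = ⨆ n : ℕ, ∫⁻ x, (min (S x) n) ^ p ∂μ := by
    rw [← lintegral_iSup]
    · refine lintegral_congr fun x => (iSup_eq_of_tendsto ?_ ?_).symm
      · intro n k hnk
        exact rpow_le_rpow (min_le_min_left _ (by exact_mod_cast hnk)) hp0.le
      · have h := (tendsto_const_nhds (x := S x)).min ENNReal.tendsto_nat_nhds_top
        rw [min_eq_left le_top] at h
        exact (continuous_rpow_const.tendsto _).comp h
    · exact fun n => (hS.min measurable_const).pow_const _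
    · intro n k hnk x
      exact rpow_le_rpow (min_le_min_left _ (by exact_mod_cast hnk)) hp0.le
  rw [hlim]
  exact iSup_le key

theorem integrable_exp_neg_mul_norm_sq (d : ℕ) {b : ℝ} (hb : 0 < b) :
    Integrable (fun u : EuclideanSpace ℝ (Fin d) => Real.exp (-b * ‖u‖ ^ 2)) := by
  have h := (GaussianFourier.integrable_cexp_neg_mul_sq_norm_add
    (V := EuclideanSpace ℝ (Fin d)) (b := (b : ℂ)) (by simpa using hb) 0 0).norm
  refine h.congr (Filter.Eventually.of_forall fun u => ?_)
  simp [Complex.norm_exp, ← Complex.ofReal_pow]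

theorem sq_norm_mul_exp_le (d : ℕ) {b : ℝ} (hb : 0 < b) (u : EuclideanSpace ℝ (Fin d)) :
    ‖u‖ ^ 2 * Real.exp (-b * ‖u‖ ^ 2) ≤ 2 / b * Real.exp (-(b / 2) * ‖u‖ ^ 2) := by
  have h1 : Real.exp (-b * ‖u‖ ^ 2) =
      Real.exp (-(b / 2) * ‖u‖ ^ 2) * Real.exp (-(b / 2 * ‖u‖ ^ 2)) := by
    rw [← Real.exp_add]; ring_nf
  have h2 : ‖u‖ ^ 2 ≤ 2 / b * Real.exp (b / 2 * ‖u‖ ^ 2) := by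
    have := Real.add_one_le_exp (b / 2 * ‖u‖ ^ 2)
    rw [div_mul_eq_mul_div, le_div_iff₀ hb]; linarith
  rw [h1, Real.exp_neg]
  have := Real.exp_pos (b / 2 * ‖u‖ ^ 2)
  have := Real.exp_pos (-(b / 2) * ‖u‖ ^ 2)
  calc _ ≤ 2 / b * Real.exp (b / 2 * ‖u‖ ^ 2) *
        (Real.exp (-(b / 2) * ‖u‖ ^ 2) * (Real.exp (b / 2 * ‖u‖ ^ 2))⁻¹) := by gcongr
    _ = _ := by field_simp

theorem integral_norm_sq_mul_exp (d : ℕ) {b : ℝ} (hb : 0 < b) :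
    Integrable (fun u : EuclideanSpace ℝ (Fin d) => ‖u‖ ^ 2 * Real.exp (-b * ‖u‖ ^ 2)) ∧
    ∫ u : EuclideanSpace ℝ (Fin d), ‖u‖ ^ 2 * Real.exp (-b * ‖u‖ ^ 2) =
      d / (2 * b) * (Real.pi / b) ^ ((d : ℝ) / 2) := by
  have hlow : ∀ x ∈ Set.Ioi (b / 2), ∀ u : EuclideanSpace ℝ (Fin d),
      ‖-‖u‖ ^ 2 * Real.exp (-x * ‖u‖ ^ 2)‖ ≤ 2 / (b / 2) * Real.exp (-(b / 2 / 2) * ‖u‖ ^ 2) := by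
    intro x hx u
    rw [norm_mul, norm_neg, Real.norm_of_nonneg (by positivity), Real.norm_of_nonneg (by positivity)]
    refine le_trans ?_ (sq_norm_mul_exp_le d (half_pos hb) u)
    have hx' : b / 2 ≤ x := le_of_lt hx
    gcongr
  have hD := hasDerivAt_integral_of_dominated_loc_of_deriv_le
    (μ := (volume : Measure (EuclideanSpace ℝ (Fin d))))
    (F := fun x u => Real.exp (-x * ‖u‖ ^ 2))
    (F' := fun x u => -‖u‖ ^ 2 * Real.exp (-x * ‖u‖ ^ 2)) (x₀ := b)
    (s := Set.Ioi (b / 2))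
    (bound := fun u => 2 / (b / 2) * Real.exp (-(b / 2 / 2) * ‖u‖ ^ 2))
    (Ioi_mem_nhds (by linarith))
    (Filter.Eventually.of_forall fun x => by fun_prop)
    (integrable_exp_neg_mul_norm_sq d hb)
    (by fun_prop)
    (Filter.Eventually.of_forall fun u x hx => hlow x hx u)
    ((integrable_exp_neg_mul_norm_sq d (half_pos (half_pos hb))).const_mul _)
    (Filter.Eventually.of_forall fun u x hx => by
      have := (((hasDerivAt_id x).neg).mul_const (‖u‖ ^ 2)).exp
      simpa [mul_comm] using this)
  obtain ⟨hi, hd⟩ := hD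
  have hneg : ∀ u : EuclideanSpace ℝ (Fin d),
      ‖u‖ ^ 2 * Real.exp (-b * ‖u‖ ^ 2) = -(-‖u‖ ^ 2 * Real.exp (-b * ‖u‖ ^ 2)) := by
    intro u; ring
  refine ⟨?_, ?_⟩
  · simp_rw [hneg]; exact hi.neg
  simp_rw [hneg]
  rw [integral_neg]
  have h2 : HasDerivAt (fun x : ℝ => ∫ u : EuclideanSpace ℝ (Fin d), Real.exp (-x * ‖u‖ ^ 2))
      (-(d / (2 * b) * (Real.pi / b) ^ ((d : ℝ) / 2))) b := by
    have h3 : HasDerivAt (fun x : ℝ => (Real.pi / x) ^ ((d : ℝ) / 2))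
      (-(d / (2 * b) * (Real.pi / b) ^ ((d : ℝ) / 2))) b := by
      have h4 := ((hasDerivAt_inv hb.ne').const_mul Real.pi).rpow_const (p := (d : ℝ) / 2)
        (Or.inl (by positivity))
      have : Real.pi * b⁻¹ ≠ 0 := by positivity
      simp only [div_eq_mul_inv] at h4 ⊢
      convert h4 using 1
      rw [Real.rpow_sub_one this]
      field_simp
    refine h3.congr_of_eventuallyEq ?_
    filter_upwards [Ioi_mem_nhds hb] with x hx
    have := GaussianFourier.integral_rexp_neg_mul_sq_norm (V := EuclideanSpace ℝ (Fin d)) (b := x) hx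
    simpa using this
  rw [hd.unique h2, neg_neg]

theorem heatKernel_nonneg (d : ℕ) {t : ℝ} (ht : 0 < t) (u : EuclideanSpace ℝ (Fin d)) :
    0 ≤ heatKernel d t u := by
  unfold heatKernel; positivity

theorem continuous_heatKernel (d : ℕ) (t : ℝ) : Continuous (heatKernel d t) := by
  unfold heatKernel; fun_prop

theorem hasFDerivAt_heatKernel (d : ℕ) (t : ℝ) (u : EuclideanSpace ℝ (Fin d)) :
    HasFDerivAt (heatKernel d t) ((-(heatKernel d t u) / (2 * t)) • innerSL ℝ u) u := by
  have h1 := (hasStrictFDerivAt_norm_sq u).hasFDerivAt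
  have h2 := (((h1.neg).mul_const (4 * t)⁻¹).exp).const_mul ((4 * Real.pi * t) ^ (-(d : ℝ) / 2))
  simp only [← div_eq_mul_inv] at h2
  refine h2.congr_fderiv ?_
  ext v
  simp [heatKernel]
  ring

theorem norm_mul_heatKernel_le (d : ℕ) {t : ℝ} (ht : 0 < t) (u : EuclideanSpace ℝ (Fin d)) :
    ‖u‖ * heatKernel d t u ≤ (1 + t) * (4 * Real.pi * t) ^ (-(d : ℝ) / 2) := by
  have h1 := Real.add_one_le_exp (‖u‖ ^ 2 / (4 * t))
  have h2 : ‖u‖ ≤ ‖u‖ ^ 2 / (4 * t) + t := by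
    rw [← sub_nonneg]
    have : ‖u‖ ^ 2 / (4 * t) + t - ‖u‖ = (‖u‖ - 2 * t) ^ 2 / (4 * t) := by field_simp; ring
    rw [this]; positivity
  have h4 : 0 ≤ ‖u‖ ^ 2 / (4 * t) := by positivity
  have h3 : ‖u‖ ≤ (1 + t) * Real.exp (‖u‖ ^ 2 / (4 * t)) := by nlinarith
  unfold heatKernel
  rw [neg_div (4 * t), Real.exp_neg]
  have := Real.exp_pos (‖u‖ ^ 2 / (4 * t))
  calc _ ≤ ((1 + t) * Real.exp (‖u‖ ^ 2 / (4 * t))) *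
        ((4 * Real.pi * t) ^ (-(d : ℝ) / 2) * (Real.exp (‖u‖ ^ 2 / (4 * t)))⁻¹) := by gcongr
    _ = _ := by field_simp

theorem integrable_heatKernel (d : ℕ) {t : ℝ} (ht : 0 < t) : Integrable (heatKernel d t) := by
  have h := (integrable_exp_neg_mul_norm_sq d (b := (4 * t)⁻¹) (by positivity)).const_mul
    ((4 * Real.pi * t) ^ (-(d : ℝ) / 2))
  refine h.congr (Filter.Eventually.of_forall fun u => ?_)
  simp only [heatKernel]
  congr 2; ring

theorem integral_heatKernel (d : ℕ) {t : ℝ} (ht : 0 < t) : ∫ u, heatKernel d t u = 1 := by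
  have h := GaussianFourier.integral_rexp_neg_mul_sq_norm (V := EuclideanSpace ℝ (Fin d))
    (b := (4 * t)⁻¹) (by positivity)
  have h1 : ∀ u : EuclideanSpace ℝ (Fin d), heatKernel d t u =
      (4 * Real.pi * t) ^ (-(d : ℝ) / 2) * Real.exp (-(4 * t)⁻¹ * ‖u‖ ^ 2) := fun u => by
    simp only [heatKernel]; congr 2; ring
  simp_rw [h1]
  rw [integral_const_mul, h, finrank_euclideanSpace_fin, div_inv_eq_mul,
    show Real.pi * (4 * t) = 4 * Real.pi * t by ring, ← Real.rpow_add (by positivity)]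
  rw [neg_div, neg_add_cancel, Real.rpow_zero]

theorem integrable_norm_mul_heatKernel (d : ℕ) {t : ℝ} (ht : 0 < t) :
    Integrable (fun u => ‖u‖ * heatKernel d t u) := by
  have h := ((integral_norm_sq_mul_exp d (b := (4 * t)⁻¹) (by positivity)).1).const_mul
    ((4 * Real.pi * t) ^ (-(d : ℝ) / 2))
  refine (h.add (integrable_heatKernel d ht)).mono'
    (continuous_norm.mul (continuous_heatKernel d t)).aestronglyMeasurable
    (Filter.Eventually.of_forall fun u => ?_)
  rw [Real.norm_of_nonneg (mul_nonneg (norm_nonneg _) (heatKernel_nonneg d ht u))]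
  have h1 : (4 * Real.pi * t) ^ (-(d : ℝ) / 2) * (‖u‖ ^ 2 * Real.exp (-(4 * t)⁻¹ * ‖u‖ ^ 2)) =
      ‖u‖ ^ 2 * heatKernel d t u := by
    simp only [heatKernel]
    rw [show -(4 * t)⁻¹ * ‖u‖ ^ 2 = -‖u‖ ^ 2 / (4 * t) by ring]; ring
  simp only [Pi.add_apply, h1]
  have := heatKernel_nonneg d ht u
  nlinarith [sq_nonneg (‖u‖ - 1), mul_nonneg (sq_nonneg (‖u‖ - 1)) this,
    mul_nonneg (sq_nonneg ‖u‖) this]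

section HeatGradient

variable {V : Type*} [NormedAddCommGroup V] [InnerProductSpace ℝ V] [CompleteSpace V]

theorem fderiv_heatOp (d : ℕ) {t : ℝ} (ht : 0 < t) {h : EuclideanSpace ℝ (Fin d) → V}
    (hc : Continuous h) (hs : HasCompactSupport h) (x : EuclideanSpace ℝ (Fin d)) (j : Fin d) :
    Integrable (fun y => (-(heatKernel d t (x - y)) / (2 * t) * (x - y) j) • h y) ∧
    fderiv ℝ (heatOp d t h) x (EuclideanSpace.single j 1) =
      ∫ y, (-(heatKernel d t (x - y)) / (2 * t) * (x - y) j) • h y := by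
  have hG := continuous_heatKernel d t
  have heq : heatOp d t h = fun x => ∫ y, heatKernel d t (x - y) • h y := by
    funext x
    have := integral_sub_left_eq_self (fun y => heatKernel d t (x - y) • h y) volume x
    simpa [heatOp] using this
  set C := (1 + t) * (4 * Real.pi * t) ^ (-(d : ℝ) / 2) / (2 * t)
  set F' : EuclideanSpace ℝ (Fin d) → EuclideanSpace ℝ (Fin d) → EuclideanSpace ℝ (Fin d) →L[ℝ] V :=
    fun x y => ((-(heatKernel d t (x - y)) / (2 * t)) • innerSL ℝ (x - y)).smulRight (h y)
  have hF'c : ∀ x, Continuous (F' x) := fun x => by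
    have : Continuous fun y => (-(heatKernel d t (x - y)) / (2 * t)) • innerSL ℝ (x - y) := by
      fun_prop
    exact ((ContinuousLinearMap.smulRightL ℝ (EuclideanSpace ℝ (Fin d)) V).continuous₂).comp
      (this.prodMk hc)
  have hbound : ∀ x y, ‖F' x y‖ ≤ C * ‖h y‖ := fun x y => by
    simp only [F', ContinuousLinearMap.norm_smulRight_apply, norm_smul, innerSL_apply_norm]
    gcongr
    rw [norm_div, norm_neg, Real.norm_of_nonneg (heatKernel_nonneg d ht _),
      Real.norm_of_nonneg (by positivity), div_mul_eq_mul_div, mul_comm]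
    exact div_le_div_of_nonneg_right (norm_mul_heatKernel_le d ht (x - y)) (by positivity)
  have hint : Integrable (fun y => C * ‖h y‖) :=
    ((hc.integrable_of_hasCompactSupport hs).norm).const_mul _
  have hF'i : ∀ x, Integrable (F' x) := fun x =>
    hint.mono' (hF'c x).aestronglyMeasurable (Filter.Eventually.of_forall (hbound x))
  have hFc : ∀ x, Continuous fun y => heatKernel d t (x - y) • h y := fun x => by fun_prop
  have hD := hasFDerivAt_integral_of_dominated_of_fderiv_le (𝕜 := ℝ)
    (μ := (volume : Measure (EuclideanSpace ℝ (Fin d))))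
    (F := fun x y => heatKernel d t (x - y) • h y) (F' := F') (x₀ := x) (s := Set.univ)
    (bound := fun y => C * ‖h y‖) Filter.univ_mem
    (Filter.Eventually.of_forall fun x => (hFc x).aestronglyMeasurable)
    ((hFc x).integrable_of_hasCompactSupport hs.smul_left)
    (hF'c x).aestronglyMeasurable
    (Filter.Eventually.of_forall fun y x _ => hbound x y) hint
    (Filter.Eventually.of_forall fun y x _ => by
      have := (hasFDerivAt_heatKernel d t (x - y)).comp x ((hasFDerivAt_id x).sub_const y)
      exact this.smul_const (h y))
  have happ : ∀ y, F' x y (EuclideanSpace.single j 1) =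
      (-(heatKernel d t (x - y)) / (2 * t) * (x - y) j) • h y := fun y => by
    simp [F', innerSL_apply_apply, EuclideanSpace.inner_single_right]
  constructor
  · simp_rw [← happ]
    exact (hF'i x).apply_continuousLinearMap _
  · rw [heq, hD.fderiv, ContinuousLinearMap.integral_apply (hF'i x)]
    simp_rw [happ]

theorem norm_integral_sq {X : Type*} [MeasurableSpace X] {μ : Measure X} [SFinite μ] {g : X → V}
    (hg : Integrable g μ) :
    Integrable (fun p : X × X => inner ℝ (g p.1) (g p.2)) (μ.prod μ) ∧
    ‖∫ y, g y ∂μ‖ ^ 2 = ∫ p : X × X, inner ℝ (g p.1) (g p.2) ∂μ.prod μ := by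
  have hi : Integrable (fun p : X × X => inner ℝ (g p.1) (g p.2)) (μ.prod μ) :=
    (hg.norm.mul_prod hg.norm).mono'
      (hg.aestronglyMeasurable.comp_fst.inner hg.aestronglyMeasurable.comp_snd)
      (Filter.Eventually.of_forall fun p => norm_inner_le_norm _ _)
  refine ⟨hi, ?_⟩
  rw [integral_prod _ hi, ← real_inner_self_eq_norm_sq, ← integral_inner hg]
  refine integral_congr_ae (Filter.Eventually.of_forall fun y => ?_)
  simp only
  rw [integral_inner hg, real_inner_comm]

end HeatGradient

/-- The explicit value of `∫ ∇G_t(x - y) ⬝ ∇G_t(x - z) dx` as a function of `v = y - z`. -/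
noncomputable def heatDissipation (d : ℕ) (t : ℝ) (v : EuclideanSpace ℝ (Fin d)) : ℝ :=
  heatKernel d (2 * t) v * ((d * t - ‖v‖ ^ 2 / 4) / (4 * t ^ 2))

theorem integral_heatKernel_mul_inner (d : ℕ) {t : ℝ} (ht : 0 < t)
    (y z : EuclideanSpace ℝ (Fin d)) :
    ∫ x, heatKernel d t (x - y) * heatKernel d t (x - z) * inner ℝ (x - y) (x - z) / (4 * t ^ 2) =
      heatDissipation d t (y - z) := by
  obtain ⟨hi, hm⟩ := integral_norm_sq_mul_exp d (b := (2 * t)⁻¹) (by positivity)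
  have hi0 := integrable_exp_neg_mul_norm_sq d (b := (2 * t)⁻¹) (by positivity)
  have hm0 := GaussianFourier.integral_rexp_neg_mul_sq_norm (V := EuclideanSpace ℝ (Fin d))
    (b := (2 * t)⁻¹) (by positivity)
  rw [finrank_euclideanSpace_fin] at hm0
  set v := y - z
  set c := (4 * Real.pi * t) ^ (-(d : ℝ) / 2) * (4 * Real.pi * t) ^ (-(d : ℝ) / 2) *
    Real.exp (-‖v‖ ^ 2 / (8 * t)) / (4 * t ^ 2)
  rw [← integral_add_right_eq_self _ ((1 / 2 : ℝ) • (y + z))]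
  have hpt : ∀ u : EuclideanSpace ℝ (Fin d),
      heatKernel d t (u + (1 / 2 : ℝ) • (y + z) - y) *
        heatKernel d t (u + (1 / 2 : ℝ) • (y + z) - z) *
        inner ℝ (u + (1 / 2 : ℝ) • (y + z) - y) (u + (1 / 2 : ℝ) • (y + z) - z) / (4 * t ^ 2) =
      c * (‖u‖ ^ 2 * Real.exp (-(2 * t)⁻¹ * ‖u‖ ^ 2) -
        ‖v‖ ^ 2 / 4 * Real.exp (-(2 * t)⁻¹ * ‖u‖ ^ 2)) := by
    intro u
    have e1 : u + (1 / 2 : ℝ) • (y + z) - y = u - (1 / 2 : ℝ) • v := by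
      simp only [v]; module
    have e2 : u + (1 / 2 : ℝ) • (y + z) - z = u + (1 / 2 : ℝ) • v := by
      simp only [v]; module
    rw [e1, e2]
    have n0 : ‖(1 / 2 : ℝ) • v‖ = ‖v‖ / 2 := by rw [norm_smul]; norm_num; ring
    have n1 := norm_sub_sq_real u ((1 / 2 : ℝ) • v)
    have n2 := norm_add_sq_real u ((1 / 2 : ℝ) • v)
    have n3 : inner ℝ (u - (1 / 2 : ℝ) • v) (u + (1 / 2 : ℝ) • v) = ‖u‖ ^ 2 - ‖v‖ ^ 2 / 4 := by
      rw [inner_sub_left, inner_add_right, inner_add_right, real_inner_self_eq_norm_sq,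
        real_inner_self_eq_norm_sq, n0, real_inner_comm u]
      ring
    have e3 : Real.exp (-‖u - (1 / 2 : ℝ) • v‖ ^ 2 / (4 * t)) *
        Real.exp (-‖u + (1 / 2 : ℝ) • v‖ ^ 2 / (4 * t)) =
        Real.exp (-‖v‖ ^ 2 / (8 * t)) * Real.exp (-(2 * t)⁻¹ * ‖u‖ ^ 2) := by
      rw [← Real.exp_add, ← Real.exp_add, n1, n2, n0]
      congr 1
      field_simp
      ring
    simp only [heatKernel, n3, c]
    linear_combination ((4 * Real.pi * t) ^ (-(d : ℝ) / 2) * (4 * Real.pi * t) ^ (-(d : ℝ) / 2) /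
      (4 * t ^ 2) * (‖u‖ ^ 2 - ‖v‖ ^ 2 / 4)) * e3
  simp_rw [hpt]
  rw [integral_const_mul, integral_sub hi (hi0.const_mul _), integral_const_mul, hm, hm0]
  have e4 : (4 * Real.pi * t) ^ (-(d : ℝ) / 2) * (4 * Real.pi * t) ^ (-(d : ℝ) / 2) *
      (Real.pi / (2 * t)⁻¹) ^ ((d : ℝ) / 2) = (4 * Real.pi * (2 * t)) ^ (-(d : ℝ) / 2) := by
    rw [← Real.mul_rpow (by positivity) (by positivity), neg_div, Real.rpow_neg (by positivity),
      Real.rpow_neg (by positivity), ← Real.inv_rpow (by positivity),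
      ← Real.inv_rpow (by positivity), ← Real.mul_rpow (by positivity) (by positivity)]
    congr 1
    field_simp
    norm_num
  simp only [heatDissipation, heatKernel, ← e4, c]
  rw [show -‖v‖ ^ 2 / (4 * (2 * t)) = -‖v‖ ^ 2 / (8 * t) by ring]
  field_simp

theorem hasDerivAt_heatKernel_time (d : ℕ) {t : ℝ} (ht : 0 < t) (v : EuclideanSpace ℝ (Fin d)) :
    HasDerivAt (fun t => -(heatKernel d (2 * t) v) / 2) (heatDissipation d t v) t := by
  have h1 := ((hasDerivAt_id t).const_mul (4 * Real.pi * 2)).rpow_const (p := -(d : ℝ) / 2)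
    (Or.inl (by simp only [id]; positivity))
  have h2 := (((hasDerivAt_inv ht.ne').const_mul (-‖v‖ ^ 2 / 8))).exp
  have h3 := (h1.mul h2).neg.div_const 2
  have e : (fun t => -(heatKernel d (2 * t) v) / 2) = fun t =>
      -((4 * Real.pi * 2 * id t) ^ (-(d : ℝ) / 2) * Real.exp (-‖v‖ ^ 2 / 8 * t⁻¹)) / 2 := by
    funext s
    simp only [heatKernel, id]
    rw [show 4 * Real.pi * (2 * s) = 4 * Real.pi * 2 * s by ring,
      show -‖v‖ ^ 2 / (4 * (2 * s)) = -‖v‖ ^ 2 / 8 * s⁻¹ by ring]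
  rw [e]
  refine h3.congr_deriv ?_
  simp only [id, heatDissipation, heatKernel]
  rw [show 4 * Real.pi * (2 * t) = 4 * Real.pi * 2 * t by ring,
      show -‖v‖ ^ 2 / (4 * (2 * t)) = -‖v‖ ^ 2 / 8 * t⁻¹ by ring,
      Real.rpow_sub_one (by positivity)]
  field_simp
  ring

theorem measurable_heatDissipation (d : ℕ) :
    Measurable fun q : ℝ × EuclideanSpace ℝ (Fin d) => heatDissipation d q.1 q.2 := by
  unfold heatDissipation heatKernel
  fun_prop

theorem abs_heatDissipation_le (d : ℕ) {ε t : ℝ} (hε : 0 < ε) (ht : ε ≤ t)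
    (v : EuclideanSpace ℝ (Fin d)) :
    |heatDissipation d t v| ≤ (4 * Real.pi * (2 * ε)) ^ (-(d : ℝ) / 2) * ((d + 2) / (4 * ε)) := by
  have ht0 : 0 < t := hε.trans_le ht
  have hs := Real.add_one_le_exp (‖v‖ ^ 2 / (4 * (2 * t)))
  set s := ‖v‖ ^ 2 / (4 * (2 * t)) with hs_def
  have hs0 : 0 ≤ s := by positivity
  have hv : ‖v‖ ^ 2 / 4 = 2 * t * s := by rw [hs_def]; field_simp
  have he : 0 < Real.exp s := Real.exp_pos s
  have h1 : Real.exp (-s) * |(d * t - ‖v‖ ^ 2 / 4) / (4 * t ^ 2)| ≤ (d + 2) / (4 * t) := by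
    have : |(d * t - ‖v‖ ^ 2 / 4) / (4 * t ^ 2)| ≤ (d + 2 * s) / (4 * t) := by
      rw [hv, show (d * t - 2 * t * s) / (4 * t ^ 2) = (d - 2 * s) / (4 * t) by field_simp, abs_div,
        abs_of_pos (show 0 < 4 * t by positivity)]
      gcongr
      rw [abs_le]
      constructor <;> linarith [(Nat.cast_nonneg d : (0 : ℝ) ≤ d)]
    rw [Real.exp_neg, inv_mul_le_iff₀ he]
    refine this.trans ?_
    rw [← mul_div_assoc (Real.exp s)]
    refine div_le_div_of_nonneg_right ?_ (by positivity)
    nlinarith [(Nat.cast_nonneg d : (0 : ℝ) ≤ d)]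
  have h2 : (4 * Real.pi * (2 * t)) ^ (-(d : ℝ) / 2) ≤ (4 * Real.pi * (2 * ε)) ^ (-(d : ℝ) / 2) := by
    refine Real.rpow_le_rpow_of_nonpos (by positivity) (by gcongr) ?_
    have := (Nat.cast_nonneg d : (0 : ℝ) ≤ d)
    linarith
  rw [heatDissipation, abs_mul, abs_of_nonneg (heatKernel_nonneg d (by positivity) v), heatKernel,
    neg_div (4 * (2 * t)), ← hs_def, mul_assoc]
  refine mul_le_mul h2 (h1.trans ?_) (by positivity) (by positivity)
  gcongr

theorem integrable_heatKernel_sub_mul (d : ℕ) {t : ℝ} (ht : 0 < t)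
    {g : EuclideanSpace ℝ (Fin d) → ℝ} (hg : Integrable g) :
    (Integrable fun p : EuclideanSpace ℝ (Fin d) × EuclideanSpace ℝ (Fin d) =>
      heatKernel d t (p.1 - p.2) * g p.2) ∧
    ∫ p : EuclideanSpace ℝ (Fin d) × EuclideanSpace ℝ (Fin d),
      heatKernel d t (p.1 - p.2) * g p.2 = ∫ y, g y := by
  have hi := Integrable.convolution_integrand (ContinuousLinearMap.mul ℝ ℝ) hg
    (integrable_heatKernel d ht)
  simp only [ContinuousLinearMap.mul_apply', mul_comm (g _)] at hi
  refine ⟨hi, ?_⟩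
  refine (integral_prod_symm _ hi).trans ?_
  simp only [integral_mul_const]
  simp_rw [integral_sub_right_eq_self (heatKernel d t), integral_heatKernel d ht, one_mul]

theorem integral_heatKernel_sub_mul_inner_le {V : Type*} [NormedAddCommGroup V]
    [InnerProductSpace ℝ V] (d : ℕ) {t : ℝ} (ht : 0 < t)
    {h : EuclideanSpace ℝ (Fin d) → V} (hc : Continuous h) (hs : HasCompactSupport h) :
    (Integrable fun p : EuclideanSpace ℝ (Fin d) × EuclideanSpace ℝ (Fin d) =>
      heatKernel d t (p.1 - p.2) * inner ℝ (h p.1) (h p.2)) ∧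
    |∫ p : EuclideanSpace ℝ (Fin d) × EuclideanSpace ℝ (Fin d),
      heatKernel d t (p.1 - p.2) * inner ℝ (h p.1) (h p.2)| ≤ ∫ y, ‖h y‖ ^ 2 := by
  have hG := continuous_heatKernel d t
  have hsq : Integrable fun y => ‖h y‖ ^ 2 := by
    refine Continuous.integrable_of_hasCompactSupport (by fun_prop) ?_
    exact hs.norm.comp_left (g := fun r : ℝ => r ^ 2) (by simp)
  obtain ⟨i2, e2⟩ := integrable_heatKernel_sub_mul d ht hsq
  have hsymm : ∀ u, heatKernel d t (-u) = heatKernel d t u := fun u => by simp [heatKernel]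
  have i1 : Integrable fun p : EuclideanSpace ℝ (Fin d) × EuclideanSpace ℝ (Fin d) =>
      heatKernel d t (p.1 - p.2) * ‖h p.1‖ ^ 2 := by
    refine i2.swap.congr (Filter.Eventually.of_forall fun p => ?_)
    simp only [Function.comp_apply, Prod.fst_swap, Prod.snd_swap]
    rw [← hsymm, neg_sub]
  have e1 : ∫ p : EuclideanSpace ℝ (Fin d) × EuclideanSpace ℝ (Fin d),
      heatKernel d t (p.1 - p.2) * ‖h p.1‖ ^ 2 = ∫ y, ‖h y‖ ^ 2 := by
    rw [← e2]
    refine Eq.trans ?_ (integral_prod_swap _)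
    refine integral_congr_ae (Filter.Eventually.of_forall fun p => ?_)
    simp only [Prod.fst_swap, Prod.snd_swap]
    rw [← hsymm, neg_sub]
  have hle : ∀ p : EuclideanSpace ℝ (Fin d) × EuclideanSpace ℝ (Fin d),
      ‖heatKernel d t (p.1 - p.2) * inner ℝ (h p.1) (h p.2)‖ ≤
        1 / 2 * (heatKernel d t (p.1 - p.2) * ‖h p.1‖ ^ 2 +
          heatKernel d t (p.1 - p.2) * ‖h p.2‖ ^ 2) := fun p => by
    have g := heatKernel_nonneg d ht (p.1 - p.2)
    rw [norm_mul, Real.norm_of_nonneg g]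
    have := norm_inner_le_norm (𝕜 := ℝ) (h p.1) (h p.2)
    have := mul_le_mul_of_nonneg_left (this.trans (show ‖h p.1‖ * ‖h p.2‖ ≤
      1 / 2 * (‖h p.1‖ ^ 2 + ‖h p.2‖ ^ 2) by nlinarith [sq_nonneg (‖h p.1‖ - ‖h p.2‖)])) g
    linarith
  have hi := (i1.add i2).const_mul (1 / 2)
  refine ⟨hi.mono' (by fun_prop) (Filter.Eventually.of_forall hle), ?_⟩
  refine (norm_integral_le_of_norm_le hi (Filter.Eventually.of_forall hle)).trans_eq ?_
  simp only [Pi.add_apply]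
  rw [integral_const_mul, integral_add i1 i2, e1, e2]
  ring

section Energy

variable {V : Type*} [NormedAddCommGroup V] [InnerProductSpace ℝ V] [CompleteSpace V]

theorem gradHeatNormSq_eq_integral (d : ℕ) {t : ℝ} (ht : 0 < t) {h : EuclideanSpace ℝ (Fin d) → V}
    (hc : Continuous h) (hs : HasCompactSupport h) (x : EuclideanSpace ℝ (Fin d)) :
    gradHeatNormSq d t h x = ∫ p : EuclideanSpace ℝ (Fin d) × EuclideanSpace ℝ (Fin d),
      heatKernel d t (x - p.1) * heatKernel d t (x - p.2) * inner ℝ (x - p.1) (x - p.2) /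
        (4 * t ^ 2) * inner ℝ (h p.1) (h p.2) := by
  have hj := fun j => norm_integral_sq (fderiv_heatOp d ht hc hs x j).1
  simp only [gradHeatNormSq, (fderiv_heatOp d ht hc hs x _).2, (hj _).2]
  rw [← integral_finsetSum _ fun j _ => (hj j).1]
  refine integral_congr_ae (Filter.Eventually.of_forall fun p => ?_)
  simp only [real_inner_smul_left, real_inner_smul_right]
  rw [PiLp.inner_apply]
  simp only [RCLike.inner_apply, conj_trivial, Finset.mul_sum, Finset.sum_div, Finset.sum_mul]
  refine Finset.sum_congr rfl fun j _ => ?_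
  field_simp
  ring

theorem integral_gradHeatNormSq (d : ℕ) {t : ℝ} (ht : 0 < t) {h : EuclideanSpace ℝ (Fin d) → V}
    (hc : Continuous h) (hs : HasCompactSupport h) :
    Integrable (gradHeatNormSq d t h) ∧
    ∫ x, gradHeatNormSq d t h x = ∫ p : EuclideanSpace ℝ (Fin d) × EuclideanSpace ℝ (Fin d),
      heatDissipation d t (p.1 - p.2) * inner ℝ (h p.1) (h p.2) := by
  set C := (1 + t) * (4 * Real.pi * t) ^ (-(d : ℝ) / 2)
  set Q : EuclideanSpace ℝ (Fin d) → EuclideanSpace ℝ (Fin d) × EuclideanSpace ℝ (Fin d) → ℝ :=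
    fun x p => heatKernel d t (x - p.1) * heatKernel d t (x - p.2) * inner ℝ (x - p.1) (x - p.2) /
        (4 * t ^ 2) * inner ℝ (h p.1) (h p.2)
  have hG := continuous_heatKernel d t
  have hI := integrable_norm_mul_heatKernel d ht
  have hh : Integrable (fun y => ‖h y‖) := (hc.integrable_of_hasCompactSupport hs).norm
  have hdom : Integrable (fun q : EuclideanSpace ℝ (Fin d) ×
      (EuclideanSpace ℝ (Fin d) × EuclideanSpace ℝ (Fin d)) =>
      C / (4 * t ^ 2) * (‖h q.2.1‖ * ‖h q.2.2‖) *
        (‖q.1 - q.2.1‖ * heatKernel d t (q.1 - q.2.1))) := by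
    have hcont : Continuous (fun q : EuclideanSpace ℝ (Fin d) ×
      (EuclideanSpace ℝ (Fin d) × EuclideanSpace ℝ (Fin d)) =>
      C / (4 * t ^ 2) * (‖h q.2.1‖ * ‖h q.2.2‖) *
        (‖q.1 - q.2.1‖ * heatKernel d t (q.1 - q.2.1))) := by fun_prop
    refine (integrable_prod_iff' hcont.aestronglyMeasurable).2
      ⟨Filter.Eventually.of_forall fun p =>
        (hI.comp_sub_right p.1).const_mul (C / (4 * t ^ 2) * (‖h p.1‖ * ‖h p.2‖)), ?_⟩
    have hnn : ∀ u, 0 ≤ heatKernel d t u := heatKernel_nonneg d ht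
    simp only [norm_mul, norm_norm, Real.norm_of_nonneg (hnn _)]
    simp_rw [integral_const_mul,
      integral_sub_right_eq_self (fun u => ‖u‖ * heatKernel d t u)]
    exact ((hh.mul_prod hh).const_mul _).mul_const _
  have hQc : Continuous (Function.uncurry Q) := by
    simp only [Q, Function.uncurry_def]
    fun_prop
  have hQ : Integrable (Function.uncurry Q) := by
    refine hdom.mono' hQc.aestronglyMeasurable (Filter.Eventually.of_forall fun q => ?_)
    obtain ⟨x, y, z⟩ := q
    have g1 := heatKernel_nonneg d ht (x - y)
    have g2 := heatKernel_nonneg d ht (x - z)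
    simp only [Function.uncurry, Q, norm_mul, norm_div, Real.norm_of_nonneg g1,
      Real.norm_of_nonneg g2, norm_pow, Real.norm_ofNat, Real.norm_of_nonneg ht.le]
    calc heatKernel d t (x - y) * heatKernel d t (x - z) * ‖inner ℝ (x - y) (x - z)‖ /
          (4 * t ^ 2) * ‖inner ℝ (h y) (h z)‖
        ≤ heatKernel d t (x - y) * heatKernel d t (x - z) * (‖x - y‖ * ‖x - z‖) /
          (4 * t ^ 2) * (‖h y‖ * ‖h z‖) := by
          gcongr
          · exact norm_inner_le_norm _ _
          · exact norm_inner_le_norm _ _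
      _ = (‖x - z‖ * heatKernel d t (x - z)) / (4 * t ^ 2) * (‖h y‖ * ‖h z‖) *
          (‖x - y‖ * heatKernel d t (x - y)) := by ring
      _ ≤ _ := by
          gcongr
          exact norm_mul_heatKernel_le d ht (x - z)
  have heq : gradHeatNormSq d t h = fun x => ∫ p, Q x p :=
    funext fun x => gradHeatNormSq_eq_integral d ht hc hs x
  refine ⟨heq ▸ hQ.integral_prod_left, ?_⟩
  simp_rw [heq]
  rw [integral_integral_swap hQ]
  refine integral_congr_ae (Filter.Eventually.of_forall fun p => ?_)
  simp only [Q]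
  rw [integral_mul_const, integral_heatKernel_mul_inner d ht]

theorem lintegral_Ioc_gradHeatNormSq_le (d : ℕ) {ε T : ℝ} (hε : 0 < ε) (hT : ε ≤ T)
    {h : EuclideanSpace ℝ (Fin d) → V} (hc : Continuous h) (hs : HasCompactSupport h) :
    ∫⁻ t in Set.Ioc ε T, ∫⁻ x, ENNReal.ofReal (gradHeatNormSq d t h x) ≤
      ENNReal.ofReal (∫ y, ‖h y‖ ^ 2) := by
  set J : ℝ → EuclideanSpace ℝ (Fin d) × EuclideanSpace ℝ (Fin d) → ℝ :=
    fun t p => heatDissipation d t (p.1 - p.2) * inner ℝ (h p.1) (h p.2)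
  have hh : Integrable (fun y => ‖h y‖) := (hc.integrable_of_hasCompactSupport hs).norm
  have hnn : ∀ t x, 0 ≤ gradHeatNormSq d t h x := fun t x =>
    Finset.sum_nonneg fun j _ => by positivity
  have hpos : ∀ t ∈ Set.Ioc ε T, 0 < t := fun t ht => hε.trans ht.1
  set C := (4 * Real.pi * (2 * ε)) ^ (-(d : ℝ) / 2) * ((d + 2) / (4 * ε))
  have hJ : Integrable (Function.uncurry J) ((volume.restrict (Set.Ioc ε T)).prod volume) := by
    have hdom : Integrable (fun q : ℝ × (EuclideanSpace ℝ (Fin d) × EuclideanSpace ℝ (Fin d)) =>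
        C * (‖h q.2.1‖ * ‖h q.2.2‖)) ((volume.restrict (Set.Ioc ε T)).prod volume) :=
      (integrable_const C).mul_prod (hh.mul_prod hh)
    refine hdom.mono' ?_ ?_
    · refine AEStronglyMeasurable.mul ?_ ?_
      · refine ((measurable_heatDissipation d).comp
          (measurable_fst.prodMk ?_)).aestronglyMeasurable
        fun_prop
      · exact Continuous.aestronglyMeasurable (by fun_prop)
    · have : ∀ᵐ q : ℝ × (EuclideanSpace ℝ (Fin d) × EuclideanSpace ℝ (Fin d))
          ∂((volume.restrict (Set.Ioc ε T)).prod volume), q.1 ∈ Set.Ioc ε T :=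
        Measure.quasiMeasurePreserving_fst.ae (ae_restrict_mem measurableSet_Ioc)
      filter_upwards [this] with q hq
      simp only [Function.uncurry, J, norm_mul]
      refine mul_le_mul (abs_heatDissipation_le d hε hq.1.le _) (norm_inner_le_norm _ _)
        (norm_nonneg _) (by positivity)
  have hx : ∀ t ∈ Set.Ioc ε T, ∫⁻ x, ENNReal.ofReal (gradHeatNormSq d t h x) =
      ENNReal.ofReal (∫ p, J t p) := fun t ht => by
    obtain ⟨hi, he⟩ := integral_gradHeatNormSq d (hpos t ht) hc hs
    rw [← ofReal_integral_eq_lintegral_ofReal hi (Filter.Eventually.of_forall (hnn t)), he]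
  have hJnn : ∀ t ∈ Set.Ioc ε T, 0 ≤ ∫ p, J t p := fun t ht => by
    rw [← (integral_gradHeatNormSq d (hpos t ht) hc hs).2]
    exact integral_nonneg (hnn t)
  have hJi : IntegrableOn (fun t => ∫ p, J t p) (Set.Ioc ε T) := hJ.integral_prod_left
  rw [setLIntegral_congr_fun measurableSet_Ioc hx, ← ofReal_integral_eq_lintegral_ofReal
    hJi ((ae_restrict_iff' measurableSet_Ioc).2 (Filter.Eventually.of_forall hJnn))]
  refine ENNReal.ofReal_le_ofReal ?_
  rw [integral_integral_swap hJ]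
  have htime : ∀ p : EuclideanSpace ℝ (Fin d) × EuclideanSpace ℝ (Fin d),
      ∫ t in Set.Ioc ε T, J t p =
        1 / 2 * (heatKernel d (2 * ε) (p.1 - p.2) * inner ℝ (h p.1) (h p.2) -
        heatKernel d (2 * T) (p.1 - p.2) * inner ℝ (h p.1) (h p.2)) := fun p => by
    simp only [J]
    rw [integral_mul_const, ← intervalIntegral.integral_of_le hT,
      intervalIntegral.integral_eq_sub_of_hasDerivAt
        (f := fun t => -(heatKernel d (2 * t) (p.1 - p.2)) / 2)
        (fun t ht => hasDerivAt_heatKernel_time d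
          (hε.trans_le (by rw [Set.uIcc_of_le hT] at ht; exact ht.1)) _)]
    · ring
    · rw [intervalIntegrable_iff_integrableOn_Ioc_of_le hT]
      refine (integrable_const C).mono'
        ((measurable_heatDissipation d).comp (measurable_id.prodMk
          measurable_const)).aestronglyMeasurable ?_
      filter_upwards [ae_restrict_mem measurableSet_Ioc] with t ht
      exact abs_heatDissipation_le d hε ht.1.le _
  simp_rw [htime]
  obtain ⟨i1, l1⟩ := integral_heatKernel_sub_mul_inner_le d (t := 2 * ε) (by positivity) hc hs
  obtain ⟨i2, l2⟩ := integral_heatKernel_sub_mul_inner_le d (t := 2 * T)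
    (mul_pos two_pos (hε.trans_le hT)) hc hs
  rw [integral_const_mul, integral_sub i1 i2]
  linarith [(abs_le.1 l1).2, (abs_le.1 l2).1]

/-- The `L²` square function estimate for the gradient of the heat semigroup. -/
theorem lintegral_Ioi_gradHeatNormSq_le (d : ℕ)
    {h : EuclideanSpace ℝ (Fin d) → V} (hc : Continuous h) (hs : HasCompactSupport h) :
    ∫⁻ t in Set.Ioi 0, ∫⁻ x, ENNReal.ofReal (gradHeatNormSq d t h x) ≤
      ENNReal.ofReal (∫ y, ‖h y‖ ^ 2) := by
  set S : ℕ → Set ℝ := fun n => Set.Ioc ((n : ℝ) + 1)⁻¹ ((n : ℝ) + 1)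
  have hS : Monotone S := fun m n hmn => by
    have : (m : ℝ) ≤ n := by exact_mod_cast hmn
    exact Set.Ioc_subset_Ioc (by gcongr) (by gcongr)
  have hU : Set.Ioi (0 : ℝ) ⊆ ⋃ n, S n := fun t (ht : 0 < t) => by
    obtain ⟨n, hn⟩ := exists_nat_gt (max t t⁻¹)
    have h1 := (le_max_left t t⁻¹).trans_lt hn
    have h2 := (le_max_right t t⁻¹).trans_lt hn
    exact Set.mem_iUnion.2 ⟨n, inv_lt_of_inv_lt₀ ht (by linarith), by linarith⟩
  refine (lintegral_mono_set hU).trans ?_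
  rw [setLIntegral_iUnion_of_directed _ (hS.directed_le)]
  refine iSup_le fun n => lintegral_Ioc_gradHeatNormSq_le d (by positivity) ?_ hc hs
  exact (inv_le_one_of_one_le₀ (by linarith [(Nat.cast_nonneg n : (0 : ℝ) ≤ n)])).trans
    (by linarith [(Nat.cast_nonneg n : (0 : ℝ) ≤ n)])

end Energy

theorem ofReal_integral_le_lintegral {X : Type*} [MeasurableSpace X] {μ : Measure X} {g : X → ℝ}
    (hg : ∀ x, 0 ≤ g x) : ENNReal.ofReal (∫ x, g x ∂μ) ≤ ∫⁻ x, ENNReal.ofReal (g x) ∂μ := by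
  by_cases hi : Integrable g μ
  · exact (ofReal_integral_eq_lintegral_ofReal hi (Filter.Eventually.of_forall hg)).le
  · simp [integral_undef hi]

theorem ofReal_rpow_integral_le {X : Type*} [MeasurableSpace X] {μ : Measure X} {g : X → ℝ}
    (hg : ∀ x, 0 ≤ g x) {p : ℝ} (hp : 0 < p) :
    ENNReal.ofReal ((∫ x, g x ^ (1 / p) ∂μ) ^ p) ≤
      (∫⁻ x, ENNReal.ofReal (g x) ^ (1 / p) ∂μ) ^ p := by
  rw [← ENNReal.ofReal_rpow_of_nonneg
    (integral_nonneg fun x => Real.rpow_nonneg (hg x) _) hp.le]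
  refine rpow_le_rpow ?_ hp.le
  refine (ofReal_integral_le_lintegral fun x => Real.rpow_nonneg (hg x) _).trans_eq ?_
  exact lintegral_congr fun x => (ENNReal.ofReal_rpow_of_nonneg (hg x) (by positivity)).symm

section SquareFunction

variable {V : Type*} [NormedAddCommGroup V] [InnerProductSpace ℝ V] [CompleteSpace V]

theorem gradHeatNormSq_nonneg (d : ℕ) (t : ℝ) (h : EuclideanSpace ℝ (Fin d) → V)
    (x : EuclideanSpace ℝ (Fin d)) : 0 ≤ gradHeatNormSq d t h x :=
  Finset.sum_nonneg fun _ _ => by positivity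

/-- The integrand of the square function, extended by zero to nonpositive times. -/
noncomputable def heatEnergy (d : ℕ) (t : ℝ) (h : EuclideanSpace ℝ (Fin d) → V)
    (x : EuclideanSpace ℝ (Fin d)) : ℝ≥0∞ :=
  (Set.Ioi (0 : ℝ)).indicator (fun t => ENNReal.ofReal (gradHeatNormSq d t h x)) t

theorem measurable_heatEnergy (d : ℕ) {f : ℝ → EuclideanSpace ℝ (Fin d) → ℝ → V}
    (hf : StronglyMeasurable
      (fun q : ℝ × EuclideanSpace ℝ (Fin d) × ℝ => f q.1 q.2.1 q.2.2))
    (hc : ∀ s θ, Continuous fun y => f s y θ) (hs : ∀ s θ, HasCompactSupport fun y => f s y θ) :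
    Measurable fun q : (ℝ × EuclideanSpace ℝ (Fin d)) × ℝ × ℝ =>
      heatEnergy d (q.1.1 - q.2.1) (fun y => f q.2.1 y q.2.2) q.1.2 := by
  set g : (ℝ × EuclideanSpace ℝ (Fin d)) × ℝ × ℝ → ℝ := fun q => ∑ j : Fin d,
    ‖∫ z, (-(heatKernel d (q.1.1 - q.2.1) (q.1.2 - z)) / (2 * (q.1.1 - q.2.1)) *
      (q.1.2 - z) j) • f q.2.1 z q.2.2‖ ^ 2
  have hg : Measurable g := by
    refine Finset.measurable_sum _ fun j _ => ?_
    refine (StronglyMeasurable.measurable (StronglyMeasurable.norm ?_)).pow_const 2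
    refine StronglyMeasurable.integral_prod_right ?_
    refine StronglyMeasurable.smul (Measurable.stronglyMeasurable ?_) (hf.comp_measurable
      (g := fun p : ((ℝ × EuclideanSpace ℝ (Fin d)) × ℝ × ℝ) × EuclideanSpace ℝ (Fin d) =>
        (p.1.2.1, p.2, p.1.2.2)) (by fun_prop))
    unfold heatKernel
    fun_prop
  have heq : (fun q : (ℝ × EuclideanSpace ℝ (Fin d)) × ℝ × ℝ =>
      heatEnergy d (q.1.1 - q.2.1) (fun y => f q.2.1 y q.2.2) q.1.2) =
      {q | 0 < q.1.1 - q.2.1}.indicator fun q => ENNReal.ofReal (g q) := by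
    funext q
    simp only [heatEnergy, Set.indicator_apply, Set.mem_Ioi, Set.mem_ofPred_eq]
    split_ifs with hq
    · simp only [gradHeatNormSq, (fderiv_heatOp d hq (hc _ _) (hs _ _) _ _).2, g]
    · rfl
  rw [heq]
  exact hg.ennreal_ofReal.indicator (measurableSet_lt measurable_const (by fun_prop))

theorem lintegral_heatEnergy_le (d : ℕ) (s : ℝ) {h : EuclideanSpace ℝ (Fin d) → V}
    (hc : Continuous h) (hs : HasCompactSupport h)
    (hm : Measurable fun q : ℝ × EuclideanSpace ℝ (Fin d) => heatEnergy d (q.1 - s) h q.2) :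
    ∫⁻ q : ℝ × EuclideanSpace ℝ (Fin d), heatEnergy d (q.1 - s) h q.2 ≤
      ∫⁻ y, ENNReal.ofReal |‖h y‖ ^ 2| := by
  have hsq : Integrable fun y => ‖h y‖ ^ 2 := by
    refine Continuous.integrable_of_hasCompactSupport (by fun_prop) ?_
    exact hs.norm.comp_left (g := fun r : ℝ => r ^ 2) (by simp)
  simp only [abs_of_nonneg (sq_nonneg ‖h _‖)]
  rw [← ofReal_integral_eq_lintegral_ofReal hsq (Filter.Eventually.of_forall fun y => sq_nonneg _),
    Measure.volume_eq_prod, lintegral_prod _ hm.aemeasurable,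
    lintegral_sub_right_eq_self (fun t => ∫⁻ x, heatEnergy d t h x)]
  refine le_trans (le_of_eq ?_) (lintegral_Ioi_gradHeatNormSq_le d hc hs)
  rw [← lintegral_indicator measurableSet_Ioi]
  refine lintegral_congr fun t => ?_
  by_cases ht : t ∈ Set.Ioi (0 : ℝ) <;> simp [heatEnergy, ht]

theorem ofReal_calG_sq_le (d : ℕ) {H : ℝ} (hH : 0 < H) (α β : EReal)
    (f : ℝ → EuclideanSpace ℝ (Fin d) → ℝ → V) (t : ℝ) (x : EuclideanSpace ℝ (Fin d)) :
    ENNReal.ofReal (calG d H α β f t x ^ 2) ≤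
      ∫⁻ s, (∫⁻ θ in {θ : ℝ | α < (θ : EReal) ∧ (θ : EReal) < β},
        heatEnergy d (t - s) (fun y => f s y θ) x ^ (1 / (2 * H))) ^ (2 * H) := by
  have h0 : ∀ s, 0 ≤ (∫ θ in {θ : ℝ | α < (θ : EReal) ∧ (θ : EReal) < β},
      (gradHeatNormSq d (t - s) (fun y => f s y θ) x) ^ (1 / (2 * H))) ^ (2 * H) := fun s =>
    Real.rpow_nonneg (integral_nonneg fun θ =>
      Real.rpow_nonneg (gradHeatNormSq_nonneg d _ _ _) _) _
  rw [calG, ← Real.sqrt_eq_rpow, Real.sq_sqrt (integral_nonneg h0)]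
  refine (ofReal_integral_le_lintegral h0).trans ?_
  refine le_trans (setLIntegral_mono_ae' measurableSet_Iio ?_) (setLIntegral_le_lintegral _ _)
  refine Filter.Eventually.of_forall fun s (hs : s < t) => ?_
  refine (ofReal_rpow_integral_le (fun θ => gradHeatNormSq_nonneg d _ _ _)
    (by positivity)).trans_eq ?_
  simp only [heatEnergy, Set.indicator_of_mem (show t - s ∈ Set.Ioi (0 : ℝ) from sub_pos.2 hs)]

end SquareFunction

theorem volume_cubeQ0_lt_top (d : ℕ) : volume (cubeQ0 d) < ∞ := by
  refine Bornology.IsBounded.measure_lt_top ?_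
  refine (Metric.isBounded_Icc (-4 : ℝ) 0).prod ?_
  refine (Metric.isBounded_closedBall (x := (0 : EuclideanSpace ℝ (Fin d)))
    (r := √(∑ _j : Fin d, 1))).subset fun x hx => ?_
  rw [mem_closedBall_zero_iff, EuclideanSpace.norm_eq]
  refine Real.sqrt_le_sqrt (Finset.sum_le_sum fun j _ => ?_)
  have := hx j
  rw [Real.norm_eq_abs, sq_abs]
  nlinarith [this.1, this.2]

theorem norm_le_of_mem_cubeQ0 (d : ℕ) {t : ℝ} {x : EuclideanSpace ℝ (Fin d)}
    (hx : (t, x) ∈ cubeQ0 d) : ‖x‖ ≤ d := by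
  rw [EuclideanSpace.norm_eq]
  refine Real.sqrt_le_iff.2 ⟨Nat.cast_nonneg d, ?_⟩
  calc ∑ j, ‖x j‖ ^ 2 ≤ ∑ _j : Fin d, (1 : ℝ) := Finset.sum_le_sum fun j _ => by
        have := hx.2 j
        rw [Real.norm_eq_abs, sq_abs]
        nlinarith [this.1, this.2]
    _ = d := by simp
    _ ≤ (d : ℝ) ^ 2 := by exact_mod_cast Nat.le_self_pow two_ne_zero d

theorem setLIntegral_ball_le_maxX (d : ℕ) (g : EuclideanSpace ℝ (Fin d) → ℝ)
    (x : EuclideanSpace ℝ (Fin d)) {r : ℝ} (hr : 0 < r) :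
    ∫⁻ y in Metric.ball x r, ENNReal.ofReal |g y| ≤
      volume (Metric.ball (0 : EuclideanSpace ℝ (Fin d)) r) * maxX d g x := by
  have h0 : volume (Metric.ball x r) ≠ 0 := (Metric.measure_ball_pos _ _ hr).ne'
  rw [← Measure.addHaar_ball_center volume x r]
  calc _ = volume (Metric.ball x r) * ((volume (Metric.ball x r))⁻¹ *
        ∫⁻ y in Metric.ball x r, ENNReal.ofReal |g y|) := by
        rw [← mul_assoc, ENNReal.mul_inv_cancel h0 measure_ball_lt_top.ne, one_mul]
    _ ≤ _ := by
        gcongr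
        exact le_iSup₂_of_le r hr le_rfl

theorem setLIntegral_Ioo_le_maxT (k : ℝ → ℝ≥0∞) (t : ℝ) {r : ℝ} (hr : 0 < r) :
    ∫⁻ s in Set.Ioo (t - r) (t + r), k s ≤ ENNReal.ofReal (2 * r) * maxT k t := by
  have h0 : ENNReal.ofReal (2 * r) ≠ 0 := (ENNReal.ofReal_pos.2 (by positivity)).ne'
  calc _ = ENNReal.ofReal (2 * r) * ((ENNReal.ofReal (2 * r))⁻¹ *
        ∫⁻ s in Set.Ioo (t - r) (t + r), k s) := by
        rw [← mul_assoc, ENNReal.mul_inv_cancel h0 ofReal_ne_top, one_mul]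
    _ ≤ _ := by
        gcongr
        exact le_iSup₂_of_le r hr le_rfl

/-- If `f(t,x,θ) = 0` for `(t,x) ∉ (-12,12) × B_{3d}`, then for every
`(t,x) ∈ Q₀`, `∫_{Q₀} |𝒢f(s,y)|² ds dy ≤ N 𝕄_t[F_f(·,x)](t)`, with `N = N(d)`. -/
theorem calG_L2_bound_compact_support (d : ℕ) (hd : 1 ≤ d) :
    ∃ N : ℝ, 0 < N ∧
      ∀ (V : Type) [NormedAddCommGroup V] [InnerProductSpace ℝ V] [CompleteSpace V]
        [TopologicalSpace.SeparableSpace V]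
        (H : ℝ), H ∈ Set.Ioo (1/2 : ℝ) 1 →
      ∀ (α β : EReal), α < β →
      ∀ (f : ℝ → EuclideanSpace ℝ (Fin d) → ℝ → V),
        StronglyMeasurable
          (fun q : ℝ × EuclideanSpace ℝ (Fin d) × ℝ => f q.1 q.2.1 q.2.2) →
        (∀ θ, ContDiff ℝ (⊤ : ℕ∞)
          (fun q : ℝ × EuclideanSpace ℝ (Fin d) => f q.1 q.2 θ)) →
        (∃ K : Set (ℝ × EuclideanSpace ℝ (Fin d)), IsCompact K ∧
          ∀ θ, tsupport (fun q : ℝ × EuclideanSpace ℝ (Fin d) => f q.1 q.2 θ) ⊆ K) →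
        (∀ (t : ℝ) (x : EuclideanSpace ℝ (Fin d)) (θ : ℝ),
          ¬(t ∈ Set.Ioo (-12 : ℝ) 12 ∧ x ∈ Metric.ball (0 : EuclideanSpace ℝ (Fin d)) (3 * d)) →
          f t x θ = 0) →
        ∀ (t : ℝ) (x : EuclideanSpace ℝ (Fin d)), (t, x) ∈ cubeQ0 d →
        ENNReal.ofReal (∫ q in cubeQ0 d, (calG d H α β f q.1 q.2)^2) ≤
          ENNReal.ofReal N * maxT (fun s => Ff d H α β f s x) t := by
  have hd0 : (0 : ℝ) < d := by exact_mod_cast hd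
  set c : ℝ≥0∞ := volume (Metric.ball (0 : EuclideanSpace ℝ (Fin d)) (4 * d))
  have hc0 : c ≠ 0 := (Metric.measure_ball_pos _ _ (by positivity)).ne'
  have hct : c ≠ ∞ := measure_ball_lt_top.ne
  refine ⟨c.toReal * 32, mul_pos (toReal_pos hc0 hct) (by norm_num), ?_⟩
  intro V _ _ _ _ H hH α β _ f hf hfc _ hf0 t x htx
  obtain ⟨hH1, hH2⟩ := hH
  have hp : 1 < 2 * H := by linarith
  have hp0 : 0 < 2 * H := by linarith
  have hcont : ∀ s θ, Continuous fun y => f s y θ := fun s θ =>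
    (hfc θ).continuous.comp (Continuous.prodMk_right s)
  have hsupp : ∀ s θ, HasCompactSupport fun y => f s y θ := fun s θ =>
    HasCompactSupport.intro (isCompact_closedBall (0 : EuclideanSpace ℝ (Fin d)) (3 * d))
      fun y hy => hf0 s y θ fun h => hy (Metric.ball_subset_closedBall h.2)
  have hmeas := measurable_heatEnergy d hf hcont hsupp
  set S : Set ℝ := {θ : ℝ | α < (θ : EReal) ∧ (θ : EReal) < β}
  set Φ : ℝ × EuclideanSpace ℝ (Fin d) → ℝ → ℝ → ℝ≥0∞ := fun q s θ =>
    heatEnergy d (q.1 - s) (fun y => f s y θ) q.2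
  have hball : Metric.ball (0 : EuclideanSpace ℝ (Fin d)) (3 * d) ⊆ Metric.ball x (4 * d) := by
    refine Metric.ball_subset_ball' ?_
    rw [dist_zero_left]
    linarith [norm_le_of_mem_cubeQ0 d htx]
  have hΦm : ∀ s θ, Measurable fun q => Φ q s θ := fun s θ =>
    hmeas.comp (f := fun q : ℝ × EuclideanSpace ℝ (Fin d) => (q, s, θ)) (by fun_prop)
  have hΦ : ∀ s θ, ∫⁻ q in cubeQ0 d, Φ q s θ ≤ (Set.Ioo (-12 : ℝ) 12).indicator
      (fun s => c * maxX d (fun y => ‖f s y θ‖ ^ 2) x) s := fun s θ => by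
    refine (setLIntegral_le_lintegral _ _).trans ((lintegral_heatEnergy_le d s (hcont s θ)
      (hsupp s θ) (hΦm s θ)).trans ?_)
    by_cases hs : s ∈ Set.Ioo (-12 : ℝ) 12
    · rw [Set.indicator_of_mem hs]
      refine le_trans (le_of_eq ?_) (setLIntegral_ball_le_maxX d _ x (by positivity))
      refine (setLIntegral_eq_of_support_subset fun y hy => ?_).symm
      by_contra hyb
      exact hy (by simp [hf0 s y θ fun h => hyb (hball h.2)])
    · simp [hf0 s _ θ fun h => hs h.1]
  have : IsFiniteMeasure (volume.restrict (cubeQ0 d)) :=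
    isFiniteMeasure_restrict.2 (volume_cubeQ0_lt_top d).ne
  calc ENNReal.ofReal (∫ q in cubeQ0 d, (calG d H α β f q.1 q.2) ^ 2)
      ≤ ∫⁻ q in cubeQ0 d, ENNReal.ofReal ((calG d H α β f q.1 q.2) ^ 2) :=
        ofReal_integral_le_lintegral fun q => sq_nonneg _
    _ ≤ ∫⁻ q in cubeQ0 d, ∫⁻ s, (∫⁻ θ in S, Φ q s θ ^ (1 / (2 * H))) ^ (2 * H) :=
        lintegral_mono fun q => ofReal_calG_sq_le d (by linarith) α β f q.1 q.2
    _ = ∫⁻ s, ∫⁻ q in cubeQ0 d, (∫⁻ θ in S, Φ q s θ ^ (1 / (2 * H))) ^ (2 * H) := by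
        refine lintegral_lintegral_swap (Measurable.aemeasurable ?_)
        refine Measurable.pow_const (Measurable.lintegral_prod_right' (f := fun p :
          ((ℝ × EuclideanSpace ℝ (Fin d)) × ℝ) × ℝ => Φ p.1.1 p.1.2 p.2 ^ (1 / (2 * H))) ?_) _
        exact (hmeas.comp (f := fun p : ((ℝ × EuclideanSpace ℝ (Fin d)) × ℝ) × ℝ =>
          (p.1.1, p.1.2, p.2)) (by fun_prop)).pow_const _
    _ ≤ ∫⁻ s, (∫⁻ θ in S, (∫⁻ q in cubeQ0 d, Φ q s θ) ^ (1 / (2 * H))) ^ (2 * H) := by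
        refine lintegral_mono fun s => ?_
        refine (lintegral_rpow_lintegral_le _ _ hp (φ := fun q θ => Φ q s θ ^ (1 / (2 * H)))
          ((hmeas.comp (f := fun p : (ℝ × EuclideanSpace ℝ (Fin d)) × ℝ =>
            (p.1, s, p.2)) (by fun_prop)).pow_const _)).trans_eq ?_
        simp only [← ENNReal.rpow_mul, one_div_mul_cancel hp0.ne', ENNReal.rpow_one]
    _ ≤ ∫⁻ s, (Set.Ioo (-12 : ℝ) 12).indicator (fun s => c * Ff d H α β f s x) s := by
        refine lintegral_mono fun s => ?_
        refine (rpow_le_rpow (lintegral_mono fun θ => rpow_le_rpow (hΦ s θ)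
          (by positivity)) hp0.le).trans_eq ?_
        by_cases hs : s ∈ Set.Ioo (-12 : ℝ) 12
        · simp only [Set.indicator_of_mem hs, Ff]
          simp_rw [mul_rpow_of_nonneg _ _ (one_div_nonneg.2 hp0.le)]
          rw [lintegral_const_mul' _ _ (rpow_ne_top_of_nonneg (by positivity) hct),
            mul_rpow_of_nonneg _ _ hp0.le, ← rpow_mul, one_div_mul_cancel hp0.ne', rpow_one]
        · simp [Set.indicator_of_notMem hs, hp0, show 0 < H by linarith]
    _ = c * ∫⁻ s in Set.Ioo (-12 : ℝ) 12, Ff d H α β f s x := by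
        rw [lintegral_indicator measurableSet_Ioo, lintegral_const_mul' _ _ hct]
    _ ≤ c * ∫⁻ s in Set.Ioo (t - 16) (t + 16), Ff d H α β f s x := by
        have ht : t ∈ Set.Icc (-4 : ℝ) 0 := htx.1
        gcongr
        · linarith [ht.2]
        · linarith [ht.1]
    _ ≤ c * (ENNReal.ofReal (2 * 16) * maxT (fun s => Ff d H α β f s x) t) := by
        gcongr
        exact setLIntegral_Ioo_le_maxT _ t (by norm_num)
    _ = _ := by
        rw [ENNReal.ofReal_mul toReal_nonneg, ofReal_toReal hct, mul_assoc]
        norm_num
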